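/- Left-most leaf invariant: let s be an if-free ground term in R-normal form and suppose s =_R C[(Dᵢ[a⃗ᵢ ⋄ b⃗ᵢ])ᵢ ⋄ t⃗], where C is an if-context whose guard holes are filled by the terms Dᵢ[a⃗ᵢ ⋄ b⃗ᵢ] (Dᵢ if-contexts) and whose leaf holes are filled by t⃗, all terms in t⃗ and in every a⃗ᵢ, b⃗ᵢ are if-free and in R-normal form, and for every index i such that Dᵢ[a⃗ᵢ ⋄ b⃗ᵢ] lies on the left-most branch of C, false ∉ a⃗ᵢ ∪ b⃗ᵢ. Then the left-most element of t⃗ is s. Symmetrically, if for every i on the right-most branch true ∉ a⃗ᵢ ∪ b⃗ᵢ, then the right-most element of t⃗ is s. -/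

import Mathlib

/-- The signature: pairing, decryption, projections, zero, key generation,
randomized encryption, equality test, if-then-else, booleans, countably many
adversarial symbols, names, plus auxiliary symbols (boxed conditionals, the
freezing symbol, and hole markers) used in some developments. -/
inductive FSym : Type
  | pair | dec | proj1 | proj2 | zero | pk | sk | enc | eq | ite | tt | ff
  | box | freeze
  | adv (i : ℕ)
  | name (n : ℕ)
  | hole (i : ℕ)
  deriving DecidableEq

/-- Ground terms over the signature. -/
inductive Tm : Type
  | app : FSym → List Tm → Tm

namespace Tm
def pairT (s t : Tm) : Tm := .app .pair [s, t]
def decT (s t : Tm) : Tm := .app .dec [s, t]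
def proj1T (s : Tm) : Tm := .app .proj1 [s]
def proj2T (s : Tm) : Tm := .app .proj2 [s]
def zeroT (s : Tm) : Tm := .app .zero [s]
def pkT (s : Tm) : Tm := .app .pk [s]
def skT (s : Tm) : Tm := .app .sk [s]
def encT (m k r : Tm) : Tm := .app .enc [m, k, r]
def eqT (s t : Tm) : Tm := .app .eq [s, t]
def iteT (b s t : Tm) : Tm := .app .ite [b, s, t]
def trueT : Tm := .app .tt []
def falseT : Tm := .app .ff []
def nameT (n : ℕ) : Tm := .app (.name n) []
def holeT (i : ℕ) : Tm := .app (.hole i) []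
def boxT (a b c : Tm) : Tm := .app .box [a, b, c]
def freezeT (b : Tm) : Tm := .app .freeze [b]
end Tm

open Tm

/-- A term is if-free if it contains no occurrence of if-then-else. -/
inductive IfFree : Tm → Prop
  | app {f : FSym} {ts : List Tm} (hf : f ≠ FSym.ite) (h : ∀ t ∈ ts, IfFree t) :
      IfFree (Tm.app f ts)

def IsIte (t : Tm) : Prop := ∃ b x y, t = iteT b x y

/-- The computation equations R1, oriented left-to-right. -/
inductive R1 : Tm → Tm → Prop
  | proj1 (x y : Tm) : R1 (proj1T (pairT x y)) x
  | proj2 (x y : Tm) : R1 (proj2T (pairT x y)) y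
  | decEnc (x y z : Tm) : R1 (decT (encT x (pkT y) z) (skT y)) x
  | eqRefl (x : Tm) : R1 (eqT x x) trueT

/-- The if-homomorphism equations R2, oriented left-to-right. -/
inductive R2 : Tm → Tm → Prop
  | homo (f : FSym) (hf : f ≠ FSym.ite) (l r : List Tm) (b x y : Tm) :
      R2 (.app f (l ++ iteT b x y :: r))
         (iteT b (.app f (l ++ x :: r)) (.app f (l ++ y :: r)))
  | guard (b a c x y : Tm) :
      R2 (iteT (iteT b a c) x y) (iteT b (iteT a x y) (iteT c x y))

/-- The if-simplification equations R3, oriented left-to-right. -/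
inductive R3 : Tm → Tm → Prop
  | same (b x : Tm) : R3 (iteT b x x) x
  | ifTrue (x y : Tm) : R3 (iteT trueT x y) x
  | ifFalse (x y : Tm) : R3 (iteT falseT x y) y
  | absorbThen (b x y z : Tm) : R3 (iteT b (iteT b x y) z) (iteT b x z)
  | absorbElse (b x y z : Tm) : R3 (iteT b x (iteT b y z)) (iteT b x z)

/-- The if-permutation equations R4 (as unoriented equations,
read here left-to-right; the oriented system restricts them). -/
inductive R4 : Tm → Tm → Prop
  | permThen (b a x y z : Tm) :
      R4 (iteT b (iteT a x y) z) (iteT a (iteT b x z) (iteT b y z))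
  | permElse (b a x y z : Tm) :
      R4 (iteT b x (iteT a y z)) (iteT a (iteT b x y) (iteT b x z))

/-- Closure of a root rewrite relation under contexts (one rewrite step). -/
inductive Step (root : Tm → Tm → Prop) : Tm → Tm → Prop
  | root {s t : Tm} : root s t → Step root s t
  | ctx {f : FSym} {l r : List Tm} {s t : Tm} :
      Step root s t → Step root (.app f (l ++ s :: r)) (.app f (l ++ t :: r))

def RRoot (s t : Tm) : Prop := R1 s t ∨ R2 s t ∨ R3 s t ∨ R4 s t

/-- The congruence =_R generated by the equations R = R1 ∪ R2 ∪ R3 ∪ R4. -/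
inductive REq : Tm → Tm → Prop
  | step {s t : Tm} : Step RRoot s t → REq s t
  | refl (t : Tm) : REq t t
  | symm {s t : Tm} : REq s t → REq t s
  | trans {s t u : Tm} : REq s t → REq t u → REq s u

/-- Irreducible for the computation rules R1.  (For an if-free term this is
exactly being in R-normal form, since all other rules of R involve an
if-then-else.) -/
def R1Nf (t : Tm) : Prop := ∀ s, ¬ Step R1 t s

/-- If-free conditionals in R-normal form. -/
def NfIfFree (t : Tm) : Prop := IfFree t ∧ R1Nf t

/-- `Leaf t u`: `u` is a leaf of the R-normal form term `t`
(seen through the grammar t ::= u | if b then t₁ else t₂). -/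
inductive Leaf : Tm → Tm → Prop
  | base {t : Tm} (h : ¬ IsIte t) : Leaf t t
  | left {b x y u : Tm} (h : Leaf x u) : Leaf (iteT b x y) u
  | right {b x y u : Tm} (h : Leaf y u) : Leaf (iteT b x y) u

/-- `Cond t c`: `c` is one of the guard conditionals of `t`. -/
inductive Cond : Tm → Tm → Prop
  | here {b x y : Tm} : Cond (iteT b x y) b
  | left {b x y c : Tm} (h : Cond x c) : Cond (iteT b x y) c
  | right {b x y c : Tm} (h : Cond y c) : Cond (iteT b x y) c

/-- Guards along the left-most branch of an if-tree. -/
inductive LGuard : Tm → Tm → Prop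
  | here {b x y : Tm} : LGuard (iteT b x y) b
  | deeper {b x y g : Tm} (h : LGuard x g) : LGuard (iteT b x y) g

/-- The left-most leaf of an if-tree. -/
inductive LLeaf : Tm → Tm → Prop
  | base {t : Tm} (h : ¬ IsIte t) : LLeaf t t
  | step {b x y l : Tm} (h : LLeaf x l) : LLeaf (iteT b x y) l

/-- Guards along the right-most branch of an if-tree. -/
inductive RGuard : Tm → Tm → Prop
  | here {b x y : Tm} : RGuard (iteT b x y) b
  | deeper {b x y g : Tm} (h : RGuard y g) : RGuard (iteT b x y) g

/-- The right-most leaf of an if-tree. -/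
inductive RLeaf : Tm → Tm → Prop
  | base {t : Tm} (h : ¬ IsIte t) : RLeaf t t
  | step {b x y l : Tm} (h : RLeaf y l) : RLeaf (iteT b x y) l

/-- Root contraction by the computation rules, the identity where none applies. -/
noncomputable def contract (u : Tm) : Tm :=
  open Classical in if h : ∃ r, R1 u r then h.choose else u

theorem R1.unique {u r r' : Tm} (h : R1 u r) (h' : R1 u r') : r = r' := by
  cases h <;> cases h' <;> rfl

theorem contract_of_R1 {u r : Tm} (h : R1 u r) : contract u = r := by
  have hex : ∃ r, R1 u r := ⟨r, h⟩
  rw [contract, dif_pos hex]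
  exact hex.choose_spec.unique h

theorem contract_of_not_R1 {u : Tm} (h : ∀ r, ¬ R1 u r) : contract u = u :=
  dif_neg fun ⟨r, hr⟩ => h r hr

/-- Apply a symbol to evaluated arguments, resolving conditionals by the valuation `v`. -/
noncomputable def combine (v : Tm → Bool) (f : FSym) (us : List Tm) : Tm :=
  match f, us with
  | .ite, [b, x, y] => if v b then x else y
  | f, us => contract (.app f us)

theorem combine_of_ne_ite (v : Tm → Bool) {f : FSym} (hf : f ≠ FSym.ite) (us : List Tm) :
    combine v f us = contract (.app f us) := by
  unfold combine
  split
  · exact absurd rfl hf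
  · rfl

mutual
/-- Evaluation of a term when the truth value of conditionals is given by `v`. -/
noncomputable def eval (v : Tm → Bool) : Tm → Tm
  | .app f ts => combine v f (evalList v ts)
/-- Evaluation of a list of terms. -/
noncomputable def evalList (v : Tm → Bool) : List Tm → List Tm
  | [] => []
  | t :: ts => eval v t :: evalList v ts
end

theorem evalList_eq_map (v : Tm → Bool) (ts : List Tm) : evalList v ts = ts.map (eval v) := by
  induction ts with
  | nil => rw [evalList, List.map_nil]
  | cons t ts ih => rw [evalList, ih, List.map_cons]

theorem eval_app (v : Tm → Bool) (f : FSym) (ts : List Tm) :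
    eval v (.app f ts) = combine v f (ts.map (eval v)) := by
  rw [eval, evalList_eq_map]

theorem eval_iteT (v : Tm → Bool) (b x y : Tm) :
    eval v (iteT b x y) = if v (eval v b) then eval v x else eval v y := by
  simp [iteT, eval_app, combine]

theorem eval_R1 (v : Tm → Bool) {s t : Tm} (h : R1 s t) : eval v s = eval v t := by
  have plain {f : FSym} (hf : ∀ us r, ¬ R1 (.app f us) r) (hne : f ≠ FSym.ite) (us : List Tm) :
      combine v f us = .app f us := by
    rw [combine_of_ne_ite v hne, contract_of_not_R1 (hf us)]
  have hpair := plain (f := .pair) (fun us r h => by cases h) (by simp)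
  have henc := plain (f := .enc) (fun us r h => by cases h) (by simp)
  have hpk := plain (f := .pk) (fun us r h => by cases h) (by simp)
  have hsk := plain (f := .sk) (fun us r h => by cases h) (by simp)
  have htt := plain (f := .tt) (fun us r h => by cases h) (by simp)
  cases h with
  | proj1 x y =>
    simp only [proj1T, pairT, eval_app, List.map, hpair]
    rw [combine_of_ne_ite v (by simp)]
    exact contract_of_R1 (.proj1 _ _)
  | proj2 x y =>
    simp only [proj2T, pairT, eval_app, List.map, hpair]
    rw [combine_of_ne_ite v (by simp)]
    exact contract_of_R1 (.proj2 _ _)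
  | decEnc x y z =>
    simp only [decT, encT, pkT, skT, eval_app, List.map, henc, hpk, hsk]
    rw [combine_of_ne_ite v (by simp)]
    exact contract_of_R1 (.decEnc _ _ _)
  | eqRefl x =>
    simp only [eqT, trueT, eval_app, List.map, htt]
    rw [combine_of_ne_ite v (by simp)]
    exact contract_of_R1 (.eqRefl _)

theorem eval_trueT (v : Tm → Bool) : eval v trueT = trueT := by
  rw [trueT, eval_app, combine_of_ne_ite v (by simp)]
  exact contract_of_not_R1 fun r h => by cases h

theorem eval_falseT (v : Tm → Bool) : eval v falseT = falseT := by
  rw [falseT, eval_app, combine_of_ne_ite v (by simp)]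
  exact contract_of_not_R1 fun r h => by cases h

theorem eval_RRoot (v : Tm → Bool) (ht : v trueT = true) (hf : v falseT = false) {s t : Tm}
    (h : RRoot s t) : eval v s = eval v t := by
  rcases h with h | h | h | h
  · exact eval_R1 v h
  · cases h with
    | homo f hne l r b x y =>
      rw [eval_iteT]
      simp only [eval_app, List.map_append, List.map_cons, eval_iteT]
      split <;> rfl
    | guard b a c x y =>
      simp only [eval_iteT]
      split <;> rfl
  · cases h <;> simp only [eval_iteT, eval_trueT, eval_falseT, ht, hf] <;> grind
  · cases h <;> simp only [eval_iteT] <;> grind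

theorem eval_REq (v : Tm → Bool) (ht : v trueT = true) (hf : v falseT = false) {s t : Tm}
    (h : REq s t) : eval v s = eval v t := by
  induction h with
  | step h =>
    induction h with
    | root h => exact eval_RRoot v ht hf h
    | ctx _ ih => simp only [eval_app, List.map_append, List.map_cons, ih]
  | refl => rfl
  | symm _ ih => exact ih.symm
  | trans _ _ ih₁ ih₂ => exact ih₁.trans ih₂

theorem eval_eq_self (v : Tm → Bool) {s : Tm} (h : IfFree s) (hn : R1Nf s) : eval v s = s := by
  induction h with
  | @app f ts hf _ ih =>
    have hargs : ts.map (eval v) = ts := by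
      conv_rhs => rw [← List.map_id ts]
      refine List.map_congr_left fun t ht => ih t ht fun u hu => ?_
      obtain ⟨l, r, rfl⟩ := List.append_of_mem ht
      exact hn _ (.ctx hu)
    rw [eval_app, hargs, combine_of_ne_ite v hf]
    exact contract_of_not_R1 fun r h => hn r (.root h)

theorem leaf_eval (v : Tm → Bool) (g : Tm) (hg : ∀ l, Leaf g l → NfIfFree l) :
    Leaf g (eval v g) := by
  by_cases hi : IsIte g
  · obtain ⟨b, x, y, rfl⟩ := hi
    rw [eval_iteT]
    split
    · exact .left (leaf_eval v x fun l hl => hg l (.left hl))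
    · exact .right (leaf_eval v y fun l hl => hg l (.right hl))
  · have h := hg g (.base hi)
    rw [eval_eq_self v h.1 h.2]
    exact .base hi
termination_by sizeOf g
decreasing_by all_goals subst_vars; simp [iteT]; omega

theorem LLeaf.eval_eq (v : Tm → Bool) {t l : Tm} (h : LLeaf t l)
    (hleaves : ∀ l, Leaf t l → NfIfFree l) (hv : ∀ g, LGuard t g → v (eval v g) = true) :
    eval v t = l := by
  induction h with
  | base hi => exact eval_eq_self v (hleaves _ (.base hi)).1 (hleaves _ (.base hi)).2
  | step _ ih =>
    rw [eval_iteT, if_pos (hv _ .here)]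
    exact ih (fun l hl => hleaves l (.left hl)) fun g hg => hv g (.deeper hg)

theorem RLeaf.eval_eq (v : Tm → Bool) {t l : Tm} (h : RLeaf t l)
    (hleaves : ∀ l, Leaf t l → NfIfFree l) (hv : ∀ g, RGuard t g → v (eval v g) = false) :
    eval v t = l := by
  induction h with
  | base hi => exact eval_eq_self v (hleaves _ (.base hi)).1 (hleaves _ (.base hi)).2
  | step _ ih =>
    rw [eval_iteT, if_neg (by simp [hv _ .here])]
    exact ih (fun l hl => hleaves l (.right hl)) fun g hg => hv g (.deeper hg)

theorem LGuard.cond {t g : Tm} (h : LGuard t g) : Cond t g := by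
  induction h with
  | here => exact .here
  | deeper _ ih => exact .left ih

theorem RGuard.cond {t g : Tm} (h : RGuard t g) : Cond t g := by
  induction h with
  | here => exact .here
  | deeper _ ih => exact .right ih

/-- left-most leaf invariant.  Let s be an if-free ground
term in R-normal form and s =_R t, where t is an if-tree whose guards are
themselves if-trees over if-free R-normal conditionals and leaves, and whose
leaves are if-free R-normal.  If no guard on the left-most (resp. right-most)
branch of t has false (resp. true) among its conditionals and leaves, then the
left-most (resp. right-most) leaf of t is s. -/
theorem stmt12 (s t : Tm) (hs : IfFree s) (hsnf : R1Nf s) (hst : REq s t)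
    (hguards : ∀ g, Cond t g →
      (∀ c, Cond g c → NfIfFree c) ∧ (∀ l, Leaf g l → NfIfFree l))
    (hleaves : ∀ l, Leaf t l → NfIfFree l) :
    ((∀ g, LGuard t g → ∀ u, (Cond g u ∨ Leaf g u) → u ≠ falseT) →
      ∀ l, LLeaf t l → l = s) ∧
    ((∀ g, RGuard t g → ∀ u, (Cond g u ∨ Leaf g u) → u ≠ trueT) →
      ∀ l, RLeaf t l → l = s) := by
  classical
  have hne : trueT ≠ falseT := by simp [trueT, falseT]
  constructor
  · intro h l hl
    let v : Tm → Bool := fun u => decide (u ≠ falseT)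
    rw [← hl.eval_eq v hleaves, ← eval_REq v (by simpa [v] using hne) (by simp [v]) hst,
      eval_eq_self v hs hsnf]
    intro g hg
    exact decide_eq_true (h g hg _ (.inr (leaf_eval v g (hguards g hg.cond).2)))
  · intro h l hl
    let v : Tm → Bool := fun u => decide (u = trueT)
    rw [← hl.eval_eq v hleaves, ← eval_REq v (by simp [v]) (by simpa [v] using hne.symm) hst,
      eval_eq_self v hs hsnf]
    intro g hg
    exact decide_eq_false (h g hg _ (.inr (leaf_eval v g (hguards g hg.cond).2)))
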